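/- arXiv:2111.07618 — 2 statements merged into one kernel-verified Lean document; each statement's English description precedes it below -/
import Mathlib

section
/- Let g : ℝⁿ → ℝ be differentiable with L-Lipschitz gradient, h₁ : ℝⁿ → ℝ ∪ {+∞} a proper lower semicontinuous convex function, h₂ : ℝⁿ → ℝ a continuous convex function, f = g + h₁ − h₂. Suppose sequences {x_k}, {x_k⁺}, {ξ_k}, {r_k}, {η_k} satisfy, for every k ≥ 1: h₁(x_k) and h₁(x_k⁺) are finite; ξ_k ∈ ∂h₂(x_k); B_k = τ_k I − τ_k s_{k−1}s_{k−1}ᵀ/(s_{k−1}ᵀs_{k−1}) + γ_k z_{k−1}z_{k−1}ᵀ/(s_{k−1}ᵀz_{k−1}) + τ_k φ_k v_{k−1}v_{k−1}ᵀ, where s_{k−1} = x_k − x_{k−1} ≠ 0, z_{k−1} = (∇g(x_k) − ∇g(x_{k−1})) + ν_k s_{k−1} with 0 ≤ ν_k ≤ ν̄, s_{k−1}ᵀz_{k−1} ≥ ν̲‖s_{k−1}‖² (ν̲ > 0), v_{k−1} = √(s_{k−1}ᵀs_{k−1})·(z_{k−1}/(s_{k−1}ᵀz_{k−1}) − s_{k−1}/(s_{k−1}ᵀs_{k−1})),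 φ̄₁φ*_k ≤ φ_k ≤ φ̄₂ with 0 ≤ φ̄₁ < 1, φ̄₂ > 0 and φ*_k = −(s_{k−1}ᵀz_{k−1})²/((s_{k−1}ᵀs_{k−1})(z_{k−1}ᵀz_{k−1}) − (s_{k−1}ᵀz_{k−1})²), γ_k ∈ [γ̲, γ̄], τ_k ∈ [τ̲, τ̄] with 0 < γ̲ ≤ γ̄ and 0 < τ̲ ≤ τ̄; d_k = x_k⁺ − x_k; r_k − (∇g(x_k) − ξ_k) − B_k d_k ∈ ∂h₁(x_k⁺); ‖r_k‖_{B_k⁻¹} ≤ (1 − θ_k)‖d_k‖_{B_k} with θ_k ∈ [θ̄, 1], θ̄ ∈ (0,1]; x_{k+1} = x_k + η_k d_k with η_k ∈ [η̄, 1], η̄ > 0; and f(x_{k+1}) ≤ f(x_k) + δη_k((∇g(x_k) − ξ_k)ᵀd_k + h₁(x_k⁺) − h₁(x_k)) with δ ∈ (0,1). If f is bounded below, then ‖d_k‖ → 0; if moreover {x_k} is bounded, then every accumulation point of {x_k} is a critical point of f. -/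
open Matrix Filter Topology RealInnerProductSpace

noncomputable section

/-- `n`-dimensional Euclidean space. -/
abbrev Euc (n : ℕ) := EuclideanSpace ℝ (Fin n)

/-- `v` is a subgradient of the extended-real-valued convex function `φ` at `x`. -/
def ESubgradAt {n : ℕ} (φ : Euc n → EReal) (v x : Euc n) : Prop :=
  ∀ y : Euc n, φ x + ((⟪v, y - x⟫ : ℝ) : EReal) ≤ φ y

/-- `v` is a subgradient of the real-valued convex function `φ` at `x`. -/
def RSubgradAt {n : ℕ} (φ : Euc n → ℝ) (v x : Euc n) : Prop :=
  ∀ y : Euc n, φ x + ⟪v, y - x⟫ ≤ φ y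

/-- Convexity of an extended-real-valued function. -/
def EConvexF {n : ℕ} (φ : Euc n → EReal) : Prop :=
  ∀ x y : Euc n, ∀ a b : ℝ, 0 ≤ a → 0 ≤ b → a + b = 1 →
    φ (a • x + b • y) ≤ (a : EReal) * φ x + (b : EReal) * φ y

/-- Properness of an extended-real-valued function: never `⊥` and finite somewhere. -/
def ProperF {n : ℕ} (φ : Euc n → EReal) : Prop :=
  (∀ x, φ x ≠ ⊥) ∧ (∃ x, φ x ≠ ⊤)

/-- The quadratic form `uᵀ B u`. -/
def quadF {n : ℕ} (B : Matrix (Fin n) (Fin n) ℝ) (u : Euc n) : ℝ :=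
  ⟪u, (Matrix.toEuclideanLin B) u⟫

/-- The scaled norm `‖u‖_B = √(uᵀ B u)`. -/
def MNorm {n : ℕ} (B : Matrix (Fin n) (Fin n) ℝ) (u : Euc n) : ℝ :=
  Real.sqrt (quadF B u)

/-- The objective `f = g + h₁ - h₂`. -/
def fObj {n : ℕ} (g : Euc n → ℝ) (h₁ : Euc n → EReal) (h₂ : Euc n → ℝ) (x : Euc n) : EReal :=
  (g x : EReal) + h₁ x - (h₂ x : EReal)

/-- The vector `v = √(sᵀs)(z/(sᵀz) - s/(sᵀs))`. -/
def vvec {n : ℕ} (s z : Euc n) : Euc n :=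
  Real.sqrt (⟪s, s⟫) • ((⟪s, z⟫)⁻¹ • z - (⟪s, s⟫)⁻¹ • s)

/-- The critical parameter `φ* = -(sᵀz)²/((sᵀs)(zᵀz) - (sᵀz)²)`. -/
def phiStar {n : ℕ} (s z : Euc n) : ℝ :=
  -(⟪s, z⟫ : ℝ) ^ 2 / ((⟪s, s⟫ : ℝ) * (⟪z, z⟫ : ℝ) - (⟪s, z⟫ : ℝ) ^ 2)

/-- The memoryless modified spectral scaling Broyden family matrix
`B = τI - τssᵀ/(sᵀs) + γzzᵀ/(sᵀz) + τφvvᵀ`. -/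
def Bmat {n : ℕ} (τ γ φ : ℝ) (s z : Euc n) : Matrix (Fin n) (Fin n) ℝ :=
  τ • (1 : Matrix (Fin n) (Fin n) ℝ)
    - (τ / (⟪s, s⟫ : ℝ)) • vecMulVec (s : Fin n → ℝ) (s : Fin n → ℝ)
    + (γ / (⟪s, z⟫ : ℝ)) • vecMulVec (z : Fin n → ℝ) (z : Fin n → ℝ)
    + (τ * φ) • vecMulVec (vvec s z : Fin n → ℝ) (vvec s z : Fin n → ℝ)

section ScalingBroydenMatrix

variable {n : ℕ}

lemma toEuclideanLin_vecMulVec_apply (a u : Euc n) :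
    Matrix.toEuclideanLin (vecMulVec (a : Fin n → ℝ) (a : Fin n → ℝ)) u = (⟪a, u⟫ : ℝ) • a := by
  ext i
  simp [Matrix.toLpLin_apply, Matrix.vecMulVec_mulVec, PiLp.inner_apply, dotProduct, mul_comm]

lemma toEuclideanLin_Bmat_apply (τ γ φ : ℝ) (s z u : Euc n) :
    Matrix.toEuclideanLin (Bmat τ γ φ s z) u =
      τ • u - (τ / ⟪s, s⟫ * ⟪s, u⟫) • s + (γ / ⟪s, z⟫ * ⟪z, u⟫) • z +
        (τ * φ * ⟪vvec s z, u⟫) • vvec s z := by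
  simp only [Bmat, map_add, map_sub, map_smul, LinearMap.add_apply, LinearMap.sub_apply,
    LinearMap.smul_apply, toEuclideanLin_vecMulVec_apply, smul_smul]
  simp [Matrix.toLpLin_one]

lemma inner_toEuclideanLin_Bmat (τ γ φ : ℝ) (s z u w : Euc n) :
    ⟪w, Matrix.toEuclideanLin (Bmat τ γ φ s z) u⟫ =
      τ * ⟪w, u⟫ - τ / ⟪s, s⟫ * ⟪s, u⟫ * ⟪s, w⟫ + γ / ⟪s, z⟫ * ⟪z, u⟫ * ⟪z, w⟫ +
        τ * φ * ⟪vvec s z, u⟫ * ⟪vvec s z, w⟫ := by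
  simp only [toEuclideanLin_Bmat_apply, inner_add_right, inner_sub_right, inner_smul_right,
    real_inner_comm w]

lemma inner_toEuclideanLin_Bmat_comm (τ γ φ : ℝ) (s z u w : Euc n) :
    ⟪w, Matrix.toEuclideanLin (Bmat τ γ φ s z) u⟫ =
      ⟪u, Matrix.toEuclideanLin (Bmat τ γ φ s z) w⟫ := by
  rw [inner_toEuclideanLin_Bmat, inner_toEuclideanLin_Bmat, real_inner_comm]
  ring

lemma inner_self_vvec {s z : Euc n} (hs : s ≠ 0) (hsz : 0 < (⟪s, z⟫ : ℝ)) :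
    (⟪vvec s z, vvec s z⟫ : ℝ) =
      (⟪s, s⟫ * ⟪z, z⟫ - ⟪s, z⟫ ^ 2) / (⟪s, z⟫ : ℝ) ^ 2 := by
  have hss : 0 < (⟪s, s⟫ : ℝ) := real_inner_self_pos.mpr hs
  have hq := Real.mul_self_sqrt hss.le
  simp only [vvec, inner_smul_left, inner_smul_right, inner_sub_left, inner_sub_right,
    real_inner_comm s z, RCLike.conj_to_real]
  calc _ = (√⟪s, s⟫ * √⟪s, s⟫) * ((⟪s, z⟫ : ℝ)⁻¹ * (⟪s, z⟫⁻¹ * ⟪z, z⟫ - ⟪s, s⟫⁻¹ * ⟪s, z⟫) -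
        ⟪s, s⟫⁻¹ * (⟪s, z⟫⁻¹ * ⟪s, z⟫ - ⟪s, s⟫⁻¹ * ⟪s, s⟫)) := by ring
    _ = _ := by
      rw [hq]
      field_simp
      ring

lemma inner_vvec_left_eq_zero {s z : Euc n} (hs : s ≠ 0) (hsz : 0 < (⟪s, z⟫ : ℝ)) :
    (⟪vvec s z, s⟫ : ℝ) = 0 := by
  have hss : 0 < (⟪s, s⟫ : ℝ) := real_inner_self_pos.mpr hs
  simp only [vvec, inner_smul_left, inner_sub_left, real_inner_comm s z, RCLike.conj_to_real]
  field_simp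
  simp

lemma neg_one_le_phiStar_mul_inner_self_vvec {s z : Euc n} (hs : s ≠ 0)
    (hsz : 0 < (⟪s, z⟫ : ℝ)) : -1 ≤ phiStar s z * ⟪vvec s z, vvec s z⟫ := by
  rw [inner_self_vvec hs hsz, phiStar]
  by_cases h : (⟪s, s⟫ * ⟪z, z⟫ - ⟪s, z⟫ ^ 2 : ℝ) = 0
  · rw [h, div_zero, zero_mul]
    norm_num
  · apply le_of_eq
    field_simp

lemma inner_self_vvec_le {s z : Euc n} {ν M : ℝ} (hs : s ≠ 0) (hν : 0 < ν)
    (hcurv : ν * ‖s‖ ^ 2 ≤ ⟪s, z⟫) (hz : ‖z‖ ≤ M * ‖s‖) :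
    (⟪vvec s z, vvec s z⟫ : ℝ) ≤ M ^ 2 / ν ^ 2 := by
  have hs0 : 0 < ‖s‖ := norm_pos_iff.mpr hs
  have hsz : 0 < (⟪s, z⟫ : ℝ) := lt_of_lt_of_le (by positivity) hcurv
  rw [inner_self_vvec hs hsz, div_le_div_iff₀ (by positivity) (by positivity),
    real_inner_self_eq_norm_sq, real_inner_self_eq_norm_sq]
  have h1 : ‖z‖ ^ 2 ≤ (M * ‖s‖) ^ 2 := by gcongr
  have h2 : (ν * ‖s‖ ^ 2) ^ 2 ≤ (⟪s, z⟫ : ℝ) ^ 2 := by gcongr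
  calc (‖s‖ ^ 2 * ‖z‖ ^ 2 - (⟪s, z⟫ : ℝ) ^ 2) * ν ^ 2
      ≤ (‖s‖ ^ 2 * (M * ‖s‖) ^ 2) * ν ^ 2 := by
        gcongr
        nlinarith [sq_nonneg (⟪s, z⟫ : ℝ), mul_le_mul_of_nonneg_left h1 (sq_nonneg ‖s‖)]
    _ = M ^ 2 * (ν * ‖s‖ ^ 2) ^ 2 := by ring
    _ ≤ M ^ 2 * (⟪s, z⟫ : ℝ) ^ 2 := by gcongr

lemma neg_le_mul_inner_self_vvec {s z : Euc n} {φ c : ℝ} (hs : s ≠ 0)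
    (hsz : 0 < (⟪s, z⟫ : ℝ)) (hc : 0 ≤ c) (hφ : c * phiStar s z ≤ φ) :
    -c ≤ φ * ⟪vvec s z, vvec s z⟫ := by
  have h1 := mul_le_mul_of_nonneg_right hφ (real_inner_self_nonneg (x := vvec s z))
  have h2 := mul_le_mul_of_nonneg_left (neg_one_le_phiStar_mul_inner_self_vvec hs hsz) hc
  linarith

/-- The scaling Broyden matrices are uniformly bounded. -/
lemma norm_toEuclideanLin_Bmat_le {s z : Euc n} {ν M τ γ φ τhi γhi φ₁ φ₂ : ℝ} (hs : s ≠ 0)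
    (hν : 0 < ν) (hcurv : ν * ‖s‖ ^ 2 ≤ ⟪s, z⟫) (hz : ‖z‖ ≤ M * ‖s‖)
    (hτ0 : 0 < τ) (hτ : τ ≤ τhi) (hγ0 : 0 < γ) (hγ : γ ≤ γhi) (hφ₁ : 0 ≤ φ₁) (hφ₂ : 0 ≤ φ₂)
    (hφl : φ₁ * phiStar s z ≤ φ) (hφu : φ ≤ φ₂) (u : Euc n) :
    ‖Matrix.toEuclideanLin (Bmat τ γ φ s z) u‖ ≤
      (τhi + τhi + γhi * (M ^ 2 / ν) + τhi * (φ₁ + φ₂ * (M ^ 2 / ν ^ 2))) * ‖u‖ := by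
  have hs0 : 0 < ‖s‖ := norm_pos_iff.mpr hs
  have hsz : 0 < (⟪s, z⟫ : ℝ) := lt_of_lt_of_le (by positivity) hcurv
  have hτhi : 0 < τhi := hτ0.trans_le hτ
  have hγhi : 0 < γhi := hγ0.trans_le hγ
  have hrank (c : ℝ) (a : Euc n) : ‖(c * ⟪a, u⟫) • a‖ ≤ |c| * ‖a‖ ^ 2 * ‖u‖ := by
    rw [norm_smul, Real.norm_eq_abs, abs_mul]
    have := mul_le_mul_of_nonneg_left (abs_real_inner_le_norm a u)
      (mul_nonneg (abs_nonneg c) (norm_nonneg a))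
    nlinarith
  have e1 : ‖τ • u‖ ≤ τhi * ‖u‖ := by
    rw [norm_smul, Real.norm_eq_abs, abs_of_pos hτ0]
    gcongr
  have e2 : ‖(τ / ⟪s, s⟫ * ⟪s, u⟫ : ℝ) • s‖ ≤ τhi * ‖u‖ := by
    refine (hrank _ _).trans ?_
    rw [real_inner_self_eq_norm_sq, abs_of_pos (by positivity), div_mul_cancel₀ _ (by positivity)]
    gcongr
  have e3 : ‖(γ / ⟪s, z⟫ * ⟪z, u⟫ : ℝ) • z‖ ≤ γhi * (M ^ 2 / ν) * ‖u‖ := by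
    refine (hrank _ _).trans ?_
    rw [abs_of_pos (by positivity)]
    have h1 : ‖z‖ ^ 2 ≤ (M * ‖s‖) ^ 2 := by gcongr
    have h2 : ‖z‖ ^ 2 / ⟪s, z⟫ ≤ M ^ 2 / ν := by
      rw [div_le_div_iff₀ hsz hν]
      calc ‖z‖ ^ 2 * ν ≤ (M * ‖s‖) ^ 2 * ν := by gcongr
        _ = M ^ 2 * (ν * ‖s‖ ^ 2) := by ring
        _ ≤ M ^ 2 * ⟪s, z⟫ := by gcongr
    have h3 : γ / ⟪s, z⟫ * ‖z‖ ^ 2 = γ * (‖z‖ ^ 2 / ⟪s, z⟫) := by ring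
    rw [h3]
    gcongr
  have e4 : ‖(τ * φ * ⟪vvec s z, u⟫ : ℝ) • vvec s z‖ ≤
      τhi * (φ₁ + φ₂ * (M ^ 2 / ν ^ 2)) * ‖u‖ := by
    refine (hrank _ _).trans ?_
    have hl := neg_le_mul_inner_self_vvec hs hsz hφ₁ hφl
    have hv := inner_self_vvec_le hs hν hcurv hz
    rw [real_inner_self_eq_norm_sq] at hl hv
    have hu : φ * ‖vvec s z‖ ^ 2 ≤ φ₂ * (M ^ 2 / ν ^ 2) := by gcongr
    have hpos : 0 ≤ φ₂ * (M ^ 2 / ν ^ 2) := by positivity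
    have habs : |φ| * ‖vvec s z‖ ^ 2 ≤ φ₁ + φ₂ * (M ^ 2 / ν ^ 2) := by
      rw [← abs_of_nonneg (sq_nonneg ‖vvec s z‖), ← abs_mul]
      exact abs_le.mpr ⟨by linarith, by linarith⟩
    rw [abs_mul, abs_of_pos hτ0, mul_assoc τ]
    gcongr
  rw [toEuclideanLin_Bmat_apply]
  refine (norm_add_le _ _).trans ?_
  have t1 := norm_add_le (τ • u - (τ / ⟪s, s⟫ * ⟪s, u⟫ : ℝ) • s)
    ((γ / ⟪s, z⟫ * ⟪z, u⟫ : ℝ) • z)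
  have t2 := norm_sub_le (τ • u) ((τ / ⟪s, s⟫ * ⟪s, u⟫ : ℝ) • s)
  linarith

set_option maxHeartbeats 800000 in
/-- The scaling Broyden matrices are uniformly positive definite. -/
lemma norm_sq_le_mul_quadF_Bmat {s z : Euc n} {ν M τ γ φ τlo γlo φ₁ : ℝ} (hs : s ≠ 0)
    (hν : 0 < ν) (hcurv : ν * ‖s‖ ^ 2 ≤ ⟪s, z⟫) (hz : ‖z‖ ≤ M * ‖s‖)
    (hτ0 : 0 < τlo) (hτ : τlo ≤ τ) (hγ0 : 0 < γlo) (hγ : γlo ≤ γ) (hφ₁ : 0 ≤ φ₁)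
    (hφ₁' : φ₁ < 1) (hφl : φ₁ * phiStar s z ≤ φ) (u : Euc n) :
    ‖u‖ ^ 2 ≤ ((1 + 2 * (M ^ 2 / ν ^ 2)) / (τlo * (1 - φ₁)) + 2 / (ν * γlo)) *
      quadF (Bmat τ γ φ s z) u := by
  have hs0 : 0 < ‖s‖ := norm_pos_iff.mpr hs
  have hss : 0 < (⟪s, s⟫ : ℝ) := real_inner_self_pos.mpr hs
  have hsz : 0 < (⟪s, z⟫ : ℝ) := lt_of_lt_of_le (by positivity) hcurv
  have hφ₁p : 0 < 1 - φ₁ := by linarith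
  obtain ⟨α, hα⟩ : ∃ α : ℝ, α = ⟪s, u⟫ / ⟪s, s⟫ := ⟨_, rfl⟩
  obtain ⟨p, hp⟩ : ∃ p : Euc n, p = u - α • s := ⟨_, rfl⟩
  have hup : u = p + α • s := by rw [hp]; abel
  have hsp : (⟪s, p⟫ : ℝ) = 0 := by
    rw [hp, inner_sub_right, inner_smul_right, hα]
    field_simp
    simp
  have hsu : (⟪s, u⟫ : ℝ) = α * ⟪s, s⟫ := by rw [hα]; field_simp
  have huu : ‖u‖ ^ 2 = ‖p‖ ^ 2 + α ^ 2 * ‖s‖ ^ 2 := by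
    rw [← real_inner_self_eq_norm_sq, ← real_inner_self_eq_norm_sq, ← real_inner_self_eq_norm_sq,
      hup]
    simp only [inner_add_left, inner_add_right, inner_smul_left, inner_smul_right, hsp,
      real_inner_comm s p, RCLike.conj_to_real]
    ring
  have hvu : (⟪vvec s z, u⟫ : ℝ) = ⟪vvec s z, p⟫ := by
    rw [hup, inner_add_right, inner_smul_right, inner_vvec_left_eq_zero hs hsz]
    ring
  have hvp : -φ₁ * ‖p‖ ^ 2 ≤ φ * (⟪vvec s z, p⟫ : ℝ) ^ 2 := by
    have hl := neg_le_mul_inner_self_vvec hs hsz hφ₁ hφl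
    rw [real_inner_self_eq_norm_sq] at hl
    rcases le_total 0 φ with h | h
    · have : 0 ≤ φ * (⟪vvec s z, p⟫ : ℝ) ^ 2 := by positivity
      nlinarith [sq_nonneg ‖p‖]
    · have hcs : (⟪vvec s z, p⟫ : ℝ) ^ 2 ≤ (‖vvec s z‖ * ‖p‖) ^ 2 :=
        sq_le_sq.mpr (by rw [abs_of_nonneg (by positivity : 0 ≤ ‖vvec s z‖ * ‖p‖)]
                         exact abs_real_inner_le_norm _ _)
      have h1 := mul_le_mul_of_nonpos_left hcs h
      have h2 := mul_le_mul_of_nonneg_right hl (sq_nonneg ‖p‖)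
      nlinarith
  have hq : (τlo * (1 - φ₁)) * ‖p‖ ^ 2 + γlo * (⟪z, u⟫ ^ 2 / ⟪s, z⟫) ≤
      quadF (Bmat τ γ φ s z) u := by
    have hform : quadF (Bmat τ γ φ s z) u =
        τ * (‖p‖ ^ 2 + φ * (⟪vvec s z, p⟫ : ℝ) ^ 2) + γ * (⟪z, u⟫ ^ 2 / ⟪s, z⟫) := by
      rw [quadF, inner_toEuclideanLin_Bmat, real_inner_self_eq_norm_sq u, huu, hvu, hsu,
        ← real_inner_self_eq_norm_sq s]
      field_simp
      ring
    rw [hform]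
    have h1 : τlo * ((1 - φ₁) * ‖p‖ ^ 2) ≤ τ * (‖p‖ ^ 2 + φ * (⟪vvec s z, p⟫ : ℝ) ^ 2) := by
      apply mul_le_mul hτ (by linarith) (by positivity) (by linarith)
    have h2 : γlo * ((⟪z, u⟫ : ℝ) ^ 2 / ⟪s, z⟫) ≤ γ * (⟪z, u⟫ ^ 2 / ⟪s, z⟫) := by gcongr
    linarith
  have hαs : α ^ 2 * ‖s‖ ^ 2 ≤
      2 * (M ^ 2 / ν ^ 2) * ‖p‖ ^ 2 + 2 / ν * (⟪z, u⟫ ^ 2 / ⟪s, z⟫) := by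
    have hzu : α * ⟪s, z⟫ = ⟪z, u⟫ - ⟪z, p⟫ := by
      rw [hup, inner_add_right, inner_smul_right, real_inner_comm s z]
      ring
    have hzp : (⟪z, p⟫ : ℝ) ^ 2 ≤ (M * ‖s‖ * ‖p‖) ^ 2 := by
      refine sq_le_sq' ?_ ?_ <;>
      nlinarith [abs_le.mp (abs_real_inner_le_norm z p),
        mul_le_mul_of_nonneg_right hz (norm_nonneg p)]
    have h1 : α ^ 2 * (⟪s, z⟫ : ℝ) ^ 2 ≤ 2 * (⟪z, u⟫ ^ 2 + (M * ‖s‖ * ‖p‖) ^ 2) := by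
      rw [← mul_pow, hzu]
      nlinarith [sq_nonneg (⟪z, u⟫ + ⟪z, p⟫ : ℝ)]
    have hr1 : ‖s‖ ^ 2 / ⟪s, z⟫ ≤ 1 / ν := by
      rw [div_le_div_iff₀ hsz hν]; linarith
    have hr2 : (‖s‖ ^ 2 / ⟪s, z⟫) ^ 2 ≤ (1 / ν) ^ 2 := by gcongr
    calc α ^ 2 * ‖s‖ ^ 2 = α ^ 2 * (⟪s, z⟫ : ℝ) ^ 2 * (‖s‖ ^ 2 / (⟪s, z⟫ : ℝ) ^ 2) := by
          field_simp
      _ ≤ 2 * (⟪z, u⟫ ^ 2 + (M * ‖s‖ * ‖p‖) ^ 2) * (‖s‖ ^ 2 / (⟪s, z⟫ : ℝ) ^ 2) := by gcongr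
      _ = 2 * M ^ 2 * ‖p‖ ^ 2 * (‖s‖ ^ 2 / ⟪s, z⟫) ^ 2 +
          2 * (⟪z, u⟫ ^ 2 / ⟪s, z⟫) * (‖s‖ ^ 2 / ⟪s, z⟫) := by
          field_simp
          ring
      _ ≤ 2 * M ^ 2 * ‖p‖ ^ 2 * (1 / ν) ^ 2 + 2 * (⟪z, u⟫ ^ 2 / ⟪s, z⟫) * (1 / ν) := by gcongr
      _ = _ := by ring
  have hq0 : 0 ≤ (⟪z, u⟫ : ℝ) ^ 2 / ⟪s, z⟫ := div_nonneg (sq_nonneg _) hsz.le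
  generalize (⟪z, u⟫ : ℝ) ^ 2 / ⟪s, z⟫ = q at hq hαs hq0
  generalize quadF (Bmat τ γ φ s z) u = Q at hq ⊢
  have hpQ : ‖p‖ ^ 2 ≤ Q / (τlo * (1 - φ₁)) := by
    rw [le_div_iff₀ (by positivity)]
    nlinarith [mul_nonneg hγ0.le hq0]
  have hqQ : q ≤ Q / γlo := by
    rw [le_div_iff₀ hγ0]
    have : 0 ≤ (τlo * (1 - φ₁)) * ‖p‖ ^ 2 := by positivity
    linarith
  calc ‖u‖ ^ 2 ≤ (1 + 2 * (M ^ 2 / ν ^ 2)) * ‖p‖ ^ 2 + 2 / ν * q := by rw [huu]; linarith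
    _ ≤ (1 + 2 * (M ^ 2 / ν ^ 2)) * (Q / (τlo * (1 - φ₁))) + 2 / ν * (Q / γlo) := by gcongr
    _ = _ := by field_simp

end ScalingBroydenMatrix

section ScaledNorm

variable {n : ℕ} {A : Matrix (Fin n) (Fin n) ℝ} {c : ℝ}

lemma quadF_nonneg_of_norm_sq_le (hc : 0 < c) (hpos : ∀ u : Euc n, ‖u‖ ^ 2 ≤ c * quadF A u)
    (u : Euc n) : 0 ≤ quadF A u :=
  nonneg_of_mul_nonneg_right ((sq_nonneg _).trans (hpos u)) hc

lemma toEuclideanLin_inv_apply (hpos : ∀ u : Euc n, ‖u‖ ^ 2 ≤ c * quadF A u) (r : Euc n) :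
    Matrix.toEuclideanLin A (Matrix.toEuclideanLin A⁻¹ r) = r := by
  have hinj : Function.Injective A.mulVec := by
    rw [← Matrix.coe_mulVecLin, ← LinearMap.ker_eq_bot, LinearMap.ker_eq_bot']
    intro u hu
    have h := hpos (WithLp.toLp 2 u)
    have h0 : Matrix.toEuclideanLin A (WithLp.toLp 2 u) = 0 := by
      rw [Matrix.mulVecLin_apply] at hu
      simp [Matrix.toLpLin_apply, hu]
    rw [quadF, h0, inner_zero_right, mul_zero] at h
    have h1 : WithLp.toLp 2 u = (0 : Euc n) := by
      rw [← norm_eq_zero]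
      nlinarith [norm_nonneg (WithLp.toLp 2 u : Euc n)]
    simpa using congrArg WithLp.ofLp h1
  have hdet : IsUnit A.det := (Matrix.isUnit_iff_isUnit_det A).mp
    (Matrix.mulVec_injective_iff_isUnit.mp hinj)
  simp [Matrix.toLpLin_apply, Matrix.mulVec_mulVec, Matrix.mul_nonsing_inv A hdet]

lemma quadF_inv (hpos : ∀ u : Euc n, ‖u‖ ^ 2 ≤ c * quadF A u) (r : Euc n) :
    quadF A⁻¹ r = quadF A (Matrix.toEuclideanLin A⁻¹ r) := by
  rw [quadF, quadF, toEuclideanLin_inv_apply hpos, real_inner_comm]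

/-- Cauchy–Schwarz inequality for the dual pair of norms `‖·‖_A` and `‖·‖_{A⁻¹}`. -/
lemma inner_le_MNorm_inv_mul_MNorm (hc : 0 < c) (hpos : ∀ u : Euc n, ‖u‖ ^ 2 ≤ c * quadF A u)
    (hsymm : ∀ u w : Euc n, ⟪w, Matrix.toEuclideanLin A u⟫ = ⟪u, Matrix.toEuclideanLin A w⟫)
    (r d : Euc n) : ⟪r, d⟫ ≤ MNorm A⁻¹ r * MNorm A d := by
  rw [MNorm, MNorm, quadF_inv hpos]
  set w := Matrix.toEuclideanLin A⁻¹ r with hw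
  have hr : Matrix.toEuclideanLin A w = r := toEuclideanLin_inv_apply hpos r
  have hexp (t : ℝ) : 0 ≤ quadF A d * (t * t) + 2 * ⟪r, d⟫ * t + quadF A w := by
    have h := quadF_nonneg_of_norm_sq_le hc hpos (w + t • d)
    have hwd : (⟪w, Matrix.toEuclideanLin A d⟫ : ℝ) = ⟪r, d⟫ := by
      rw [hsymm, hr, real_inner_comm]
    have heq : quadF A (w + t • d) = quadF A d * (t * t) + 2 * ⟪r, d⟫ * t + quadF A w := by
      simp only [quadF, map_add, map_smul, inner_add_left, inner_add_right, inner_smul_left,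
        inner_smul_right, hwd, hr, RCLike.conj_to_real, real_inner_comm r d]
      ring
    rwa [heq] at h
  have hdisc := discrim_le_zero hexp
  rw [discrim] at hdisc
  rw [← Real.sqrt_mul (quadF_nonneg_of_norm_sq_le hc hpos w)]
  apply Real.le_sqrt_of_sq_le
  nlinarith

/-- An inexactness criterion in the scaled norms yields sufficient decrease of the model. -/
lemma inner_sub_quadF_le (hc : 0 < c) (hpos : ∀ u : Euc n, ‖u‖ ^ 2 ≤ c * quadF A u)
    (hsymm : ∀ u w : Euc n, ⟪w, Matrix.toEuclideanLin A u⟫ = ⟪u, Matrix.toEuclideanLin A w⟫)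
    {r d : Euc n} {θ : ℝ} (hres : MNorm A⁻¹ r ≤ (1 - θ) * MNorm A d) :
    ⟪r, d⟫ - quadF A d ≤ -θ * quadF A d := by
  have h1 := inner_le_MNorm_inv_mul_MNorm hc hpos hsymm r d
  have h2 := mul_le_mul_of_nonneg_right hres (Real.sqrt_nonneg (quadF A d))
  have h3 := Real.mul_self_sqrt (quadF_nonneg_of_norm_sq_le hc hpos d)
  simp only [MNorm] at h1 h2
  rw [mul_assoc, h3] at h2
  linarith

lemma norm_sq_le_of_MNorm_inv_le {C : ℝ} (hc : 0 < c)
    (hpos : ∀ u : Euc n, ‖u‖ ^ 2 ≤ c * quadF A u)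
    (hbd : ∀ u : Euc n, ‖Matrix.toEuclideanLin A u‖ ≤ C * ‖u‖) {r d : Euc n}
    (hres : MNorm A⁻¹ r ≤ MNorm A d) : ‖r‖ ^ 2 ≤ C ^ 2 * c * C * ‖d‖ ^ 2 := by
  rw [MNorm, MNorm, quadF_inv hpos,
    Real.sqrt_le_sqrt_iff (quadF_nonneg_of_norm_sq_le hc hpos d)] at hres
  set w := Matrix.toEuclideanLin A⁻¹ r with hw
  have hr : Matrix.toEuclideanLin A w = r := toEuclideanLin_inv_apply hpos r
  have hd : quadF A d ≤ C * ‖d‖ ^ 2 := by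
    calc quadF A d ≤ ‖d‖ * ‖Matrix.toEuclideanLin A d‖ := real_inner_le_norm _ _
      _ ≤ ‖d‖ * (C * ‖d‖) := by gcongr; exact hbd d
      _ = C * ‖d‖ ^ 2 := by ring
  calc ‖r‖ ^ 2 = ‖Matrix.toEuclideanLin A w‖ ^ 2 := by rw [hr]
    _ ≤ (C * ‖w‖) ^ 2 := by gcongr; exact hbd w
    _ = C ^ 2 * ‖w‖ ^ 2 := by ring
    _ ≤ C ^ 2 * (c * quadF A w) := by gcongr; exact hpos w
    _ ≤ C ^ 2 * (c * (C * ‖d‖ ^ 2)) := by gcongr; exact hres.trans hd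
    _ = _ := by ring

end ScaledNorm

section Subgradients

variable {n : ℕ}

/-- Subgradients of a continuous function along a convergent sequence are eventually bounded. -/
lemma eventually_norm_le_of_RSubgradAt {h : Euc n → ℝ} (hcont : Continuous h)
    {x ξ : ℕ → Euc n} {xbar : Euc n} (hx : Tendsto x atTop (𝓝 xbar))
    (hξ : ∀ i, RSubgradAt h (ξ i) (x i)) : ∃ C : ℝ, ∀ᶠ i in atTop, ‖ξ i‖ ≤ C := by
  obtain ⟨C, hC⟩ := (isCompact_closedBall xbar 2).exists_bound_of_continuousOn hcont.continuousOn
  refine ⟨2 * C, ?_⟩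
  filter_upwards [hx (Metric.closedBall_mem_nhds xbar one_pos)] with i hi
  have hi' : ‖x i - xbar‖ ≤ 1 := by simpa [dist_eq_norm] using hi
  have hxi := hC (x i) (by rw [mem_closedBall_iff_norm]; linarith)
  rcases eq_or_ne (ξ i) 0 with h0 | h0
  · rw [h0, norm_zero]
    linarith [norm_nonneg (h (x i))]
  have hpos : 0 < ‖ξ i‖ := norm_pos_iff.mpr h0
  have hy := hC (x i + ‖ξ i‖⁻¹ • ξ i) (by
    rw [mem_closedBall_iff_norm, add_sub_right_comm]
    refine (norm_add_le _ _).trans ?_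
    rw [norm_smul, norm_inv, norm_norm, inv_mul_cancel₀ hpos.ne']
    linarith)
  have hsub := hξ i (x i + ‖ξ i‖⁻¹ • ξ i)
  rw [add_sub_cancel_left, inner_smul_right, real_inner_self_eq_norm_sq, sq, ← mul_assoc,
    inv_mul_cancel₀ hpos.ne', one_mul] at hsub
  rw [Real.norm_eq_abs] at hxi hy
  linarith [(abs_le.mp hxi).1, (abs_le.mp hy).2]

lemma RSubgradAt_of_tendsto {h : Euc n → ℝ} (hcont : Continuous h) {x ξ : ℕ → Euc n}
    {xbar w : Euc n} (hx : Tendsto x atTop (𝓝 xbar)) (hw : Tendsto ξ atTop (𝓝 w))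
    (hξ : ∀ i, RSubgradAt h (ξ i) (x i)) : RSubgradAt h w xbar := fun y =>
  le_of_tendsto (((hcont.tendsto xbar).comp hx).add (hw.inner (tendsto_const_nhds.sub hx)))
    (Eventually.of_forall fun i => hξ i y)

lemma ESubgradAt_of_tendsto {h : Euc n → EReal} (hlsc : LowerSemicontinuous h)
    (hbot : ∀ x, h x ≠ ⊥) {x v : ℕ → Euc n} {xbar w : Euc n}
    (hx : Tendsto x atTop (𝓝 xbar)) (hv : Tendsto v atTop (𝓝 w))
    (hsub : ∀ i, ESubgradAt h (v i) (x i)) : ESubgradAt h w xbar := by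
  intro y
  by_cases hy : h y = ⊤
  · rw [hy]; exact le_top
  have hyr : h y = ((h y).toReal : EReal) := (EReal.coe_toReal hy (hbot y)).symm
  have hle (i : ℕ) : h (x i) ≤ (((h y).toReal - ⟪v i, y - x i⟫ : ℝ) : EReal) := by
    have h1 := hsub i y
    rw [hyr] at h1
    rw [EReal.coe_sub]
    exact EReal.le_sub_iff_add_le (Or.inl (EReal.coe_ne_bot _)) (Or.inl (EReal.coe_ne_top _))
      |>.mpr h1
  have hlim : Tendsto (fun i => (((h y).toReal - ⟪v i, y - x i⟫ : ℝ) : EReal)) atTop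
      (𝓝 (((h y).toReal - ⟪w, y - xbar⟫ : ℝ) : EReal)) :=
    (continuous_coe_real_ereal.tendsto _).comp
      (tendsto_const_nhds.sub (hv.inner (tendsto_const_nhds.sub hx)))
  have hmain : h xbar ≤ (((h y).toReal - ⟪w, y - xbar⟫ : ℝ) : EReal) := by
    refine le_of_forall_lt fun a ha => ?_
    by_contra hcon
    obtain ⟨b, hab, hb⟩ := exists_between ha
    have hb' : b ≤ (((h y).toReal - ⟪w, y - xbar⟫ : ℝ) : EReal) := by
      refine ge_of_tendsto hlim ?_
      filter_upwards [hx.eventually (hlsc xbar b hb)] with i hi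
      exact hi.le.trans (hle i)
    exact hcon (hab.trans_le hb')
  rw [EReal.coe_sub] at hmain
  rw [hyr]
  exact EReal.le_sub_iff_add_le (Or.inl (EReal.coe_ne_bot _)) (Or.inl (EReal.coe_ne_top _))
    |>.mp hmain

lemma ESubgradAt.toReal_add_inner_le {h : Euc n → EReal} {v x y : Euc n}
    (hsub : ESubgradAt h v x) (hbot : ∀ x, h x ≠ ⊥) (hx : h x ≠ ⊤) (hy : h y ≠ ⊤) :
    (h x).toReal + ⟪v, y - x⟫ ≤ (h y).toReal := by
  have h1 := hsub y
  rw [← EReal.coe_toReal hx (hbot x), ← EReal.coe_toReal hy (hbot y), ← EReal.coe_add,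
    EReal.coe_le_coe_iff] at h1
  exact h1

lemma fObj_eq_coe (g : Euc n → ℝ) {h₁ : Euc n → EReal} (h₂ : Euc n → ℝ) {x : Euc n}
    (hbot : h₁ x ≠ ⊥) (htop : h₁ x ≠ ⊤) :
    fObj g h₁ h₂ x = ((g x + (h₁ x).toReal - h₂ x : ℝ) : EReal) := by
  rw [fObj, ← EReal.coe_toReal htop hbot]
  norm_cast

end Subgradients

/-- The steps of a descent method with quadratic decrease on a function bounded below vanish. -/
lemma tendsto_zero_of_sq_decrease {F a : ℕ → ℝ} {c κ : ℝ} (hκ : 0 < κ) (hF : ∀ k, c ≤ F k)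
    (hdec : ∀ k, F (k + 1) ≤ F k - κ * a k ^ 2) : Tendsto a atTop (𝓝 0) := by
  have hanti : Antitone F := antitone_nat_of_succ_le fun k => by
    nlinarith [hdec k, sq_nonneg (a k)]
  have hlim := tendsto_atTop_ciInf hanti ⟨c, by rintro _ ⟨k, rfl⟩; exact hF k⟩
  have hdiff : Tendsto (fun k => (F k - F (k + 1)) / κ) atTop (𝓝 0) := by
    simpa using (hlim.sub (hlim.comp (tendsto_add_atTop_nat 1))).div_const κ
  have hsq : Tendsto (fun k => a k ^ 2) atTop (𝓝 0) :=
    squeeze_zero (fun k => sq_nonneg _)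
      (fun k => by rw [le_div_iff₀ hκ]; linarith [hdec k]) hdiff
  have habs := hsq.sqrt
  simp only [Real.sqrt_sq_eq_abs, Real.sqrt_zero] at habs
  exact (tendsto_zero_iff_abs_tendsto_zero a).mpr habs

/-- global convergence of the inexact proximal DC Newton-type method with
the memoryless modified spectral scaling Broyden family matrices: `‖d_k‖ → 0`, and if
`{x_k}` is bounded then every accumulation point is a critical point of `f`. -/
theorem inexact_proximal_DC_Newton_broyden_global_convergence
    {n : ℕ} (L νlo νhi φbar₁ φbar₂ γlo γhi τlo τhi δ θbar ηbar : ℝ)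
    (g : Euc n → ℝ) (g' : Euc n → Euc n)
    (h₁ : Euc n → EReal) (h₂ : Euc n → ℝ)
    (x xp ξ r d : ℕ → Euc n) (B : ℕ → Matrix (Fin n) (Fin n) ℝ)
    (θ η ν γ τ φ : ℕ → ℝ)
    (hL : 0 ≤ L)
    (hg : ∀ y : Euc n, HasGradientAt g (g' y) y)
    (hLip : ∀ u v : Euc n, ‖g' u - g' v‖ ≤ L * ‖u - v‖)
    (hprop : ProperF h₁) (hlsc : LowerSemicontinuous h₁) (hconv : EConvexF h₁)
    (hh₂cont : Continuous h₂) (hh₂conv : ConvexOn ℝ Set.univ h₂)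
    (hνlo : 0 < νlo) (hνhi : 0 ≤ νhi)
    (hφ₁0 : 0 ≤ φbar₁) (hφ₁1 : φbar₁ < 1) (hφ₂ : 0 < φbar₂)
    (hγlo : 0 < γlo) (hγbd : γlo ≤ γhi) (hτlo : 0 < τlo) (hτbd : τlo ≤ τhi)
    (hθbar : 0 < θbar) (hθbar1 : θbar ≤ 1)
    (hδ0 : 0 < δ) (hδ1 : δ < 1) (hηbar : 0 < ηbar)
    (hfin : ∀ k, h₁ (x (k + 1)) ≠ ⊤) (hfinp : ∀ k, h₁ (xp (k + 1)) ≠ ⊤)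
    (hξ : ∀ k, RSubgradAt h₂ (ξ (k + 1)) (x (k + 1)))
    -- the quasi-Newton data at iteration `k + 1`, built from
    -- `s_k = x_{k+1} - x_k` and `z_k = ∇g(x_{k+1}) - ∇g(x_k) + ν_{k+1} s_k`
    (hs : ∀ k, x (k + 1) - x k ≠ 0)
    (hν : ∀ k, 0 ≤ ν (k + 1) ∧ ν (k + 1) ≤ νhi)
    (hcurv : ∀ k, νlo * ‖x (k + 1) - x k‖ ^ 2 ≤
      ⟪x (k + 1) - x k, (g' (x (k + 1)) - g' (x k)) + ν (k + 1) • (x (k + 1) - x k)⟫)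
    (hφ : ∀ k, φbar₁ * phiStar (x (k + 1) - x k)
        ((g' (x (k + 1)) - g' (x k)) + ν (k + 1) • (x (k + 1) - x k)) ≤ φ (k + 1) ∧
      φ (k + 1) ≤ φbar₂)
    (hγ : ∀ k, γlo ≤ γ (k + 1) ∧ γ (k + 1) ≤ γhi)
    (hτ : ∀ k, τlo ≤ τ (k + 1) ∧ τ (k + 1) ≤ τhi)
    (hB : ∀ k, B (k + 1) = Bmat (τ (k + 1)) (γ (k + 1)) (φ (k + 1)) (x (k + 1) - x k)
      ((g' (x (k + 1)) - g' (x k)) + ν (k + 1) • (x (k + 1) - x k)))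
    (hd : ∀ k, d (k + 1) = xp (k + 1) - x (k + 1))
    (hr : ∀ k, ESubgradAt h₁
      (r (k + 1) - (g' (x (k + 1)) - ξ (k + 1)) -
        (Matrix.toEuclideanLin (B (k + 1))) (d (k + 1))) (xp (k + 1)))
    (hres : ∀ k, MNorm (B (k + 1))⁻¹ (r (k + 1)) ≤ (1 - θ (k + 1)) * MNorm (B (k + 1)) (d (k + 1)))
    (hθ : ∀ k, θbar ≤ θ (k + 1) ∧ θ (k + 1) ≤ 1)
    (hη : ∀ k, ηbar ≤ η (k + 1) ∧ η (k + 1) ≤ 1)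
    (hstep : ∀ k, x (k + 2) = x (k + 1) + η (k + 1) • d (k + 1))
    (hls : ∀ k, fObj g h₁ h₂ (x (k + 2)) ≤ fObj g h₁ h₂ (x (k + 1)) +
      ((δ * η (k + 1) * (⟪g' (x (k + 1)) - ξ (k + 1), d (k + 1)⟫ +
        (h₁ (xp (k + 1))).toReal - (h₁ (x (k + 1))).toReal) : ℝ) : EReal))
    (hbdd : ∃ c : ℝ, ∀ y : Euc n, (c : EReal) ≤ fObj g h₁ h₂ y) :
    Tendsto (fun k => ‖d k‖) atTop (𝓝 0) ∧
    ((∃ R : ℝ, ∀ k, ‖x k‖ ≤ R) →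
      ∀ xbar : Euc n,
        (∃ φs : ℕ → ℕ, StrictMono φs ∧ Tendsto (fun i => x (φs i)) atTop (𝓝 xbar)) →
        ∃ v w : Euc n, ESubgradAt h₁ v xbar ∧ RSubgradAt h₂ w xbar ∧
          g' xbar + v - w = 0) := by
  obtain ⟨M, hM⟩ : ∃ M : ℝ, M = L + νhi := ⟨_, rfl⟩
  have hz (k : ℕ) : ‖(g' (x (k + 1)) - g' (x k)) + ν (k + 1) • (x (k + 1) - x k)‖ ≤
      M * ‖x (k + 1) - x k‖ := by
    refine (norm_add_le _ _).trans ?_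
    rw [norm_smul, Real.norm_eq_abs, abs_of_nonneg (hν k).1, hM, add_mul]
    gcongr
    · exact hLip _ _
    · exact (hν k).2
  have hφ₁p : 0 < 1 - φbar₁ := by linarith
  obtain ⟨c, hc, hpos⟩ : ∃ c : ℝ, 0 < c ∧ ∀ k, ∀ u : Euc n,
      ‖u‖ ^ 2 ≤ c * quadF (B (k + 1)) u := by
    refine ⟨(1 + 2 * (M ^ 2 / νlo ^ 2)) / (τlo * (1 - φbar₁)) + 2 / (νlo * γlo), by positivity,
      fun k u => ?_⟩
    rw [hB k]
    exact norm_sq_le_mul_quadF_Bmat (hs k) hνlo (hcurv k) (hz k) hτlo (hτ k).1 hγlo (hγ k).1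
      hφ₁0 hφ₁1 (hφ k).1 u
  obtain ⟨C, hbd⟩ : ∃ C : ℝ, ∀ k, ∀ u : Euc n,
      ‖Matrix.toEuclideanLin (B (k + 1)) u‖ ≤ C * ‖u‖ := by
    refine ⟨τhi + τhi + γhi * (M ^ 2 / νlo) + τhi * (φbar₁ + φbar₂ * (M ^ 2 / νlo ^ 2)),
      fun k u => ?_⟩
    rw [hB k]
    exact norm_toEuclideanLin_Bmat_le (hs k) hνlo (hcurv k) (hz k) (hτlo.trans_le (hτ k).1)
      (hτ k).2 (hγlo.trans_le (hγ k).1) (hγ k).2 hφ₁0 hφ₂.le (hφ k).1 (hφ k).2 u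
  have hsymm (k : ℕ) (u w : Euc n) : (⟪w, Matrix.toEuclideanLin (B (k + 1)) u⟫ : ℝ) =
      ⟪u, Matrix.toEuclideanLin (B (k + 1)) w⟫ := by
    rw [hB k]
    exact inner_toEuclideanLin_Bmat_comm _ _ _ _ _ _ _
  have hmodel (k : ℕ) : ⟪g' (x (k + 1)) - ξ (k + 1), d (k + 1)⟫ + (h₁ (xp (k + 1))).toReal -
      (h₁ (x (k + 1))).toReal ≤ -(θbar / c * ‖d (k + 1)‖ ^ 2) := by
    have h1 := (hr k).toReal_add_inner_le hprop.1 (hfinp k) (hfin k)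
    have hneg : x (k + 1) - xp (k + 1) = -d (k + 1) := by rw [hd k]; abel
    rw [hneg, inner_neg_right, inner_sub_left, inner_sub_left,
      real_inner_comm (d (k + 1)) (Matrix.toEuclideanLin (B (k + 1)) (d (k + 1)))] at h1
    have h2 := inner_sub_quadF_le hc (hpos k) (hsymm k) (hres k)
    have h3 : θbar / c * ‖d (k + 1)‖ ^ 2 ≤ θ (k + 1) * quadF (B (k + 1)) (d (k + 1)) := by
      calc θbar / c * ‖d (k + 1)‖ ^ 2
          ≤ θbar / c * (c * quadF (B (k + 1)) (d (k + 1))) := by gcongr; exact hpos k _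
        _ = θbar * quadF (B (k + 1)) (d (k + 1)) := by field_simp
        _ ≤ θ (k + 1) * quadF (B (k + 1)) (d (k + 1)) :=
          mul_le_mul_of_nonneg_right (hθ k).1 (quadF_nonneg_of_norm_sq_le hc (hpos k) _)
    rw [quadF] at h2 h3
    linarith
  have hd0 : Tendsto (fun k => ‖d (k + 1)‖) atTop (𝓝 0) := by
    obtain ⟨b, hb⟩ := hbdd
    have hF (k : ℕ) := fObj_eq_coe g h₂ (hprop.1 _) (hfin k)
    refine tendsto_zero_of_sq_decrease (κ := δ * ηbar * (θbar / c)) (c := b)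
      (F := fun k => g (x (k + 1)) + (h₁ (x (k + 1))).toReal - h₂ (x (k + 1))) (by positivity)
      (fun k => ?_) (fun k => ?_)
    · have := hb (x (k + 1))
      rwa [hF, EReal.coe_le_coe_iff] at this
    · have h1 := hls k
      rw [hF (k + 1), hF k, ← EReal.coe_add, EReal.coe_le_coe_iff] at h1
      have hη0 : 0 < η (k + 1) := hηbar.trans_le (hη k).1
      have h2 := mul_le_mul_of_nonneg_left (hmodel k) (mul_pos hδ0 hη0).le
      have h3 : δ * ηbar * (θbar / c * ‖d (k + 1)‖ ^ 2) ≤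
          δ * η (k + 1) * (θbar / c * ‖d (k + 1)‖ ^ 2) := by
        gcongr
        exact (hη k).1
      simp only [add_assoc, one_add_one_eq_two] at h1 ⊢
      linarith
  refine ⟨(tendsto_add_atTop_iff_nat 1).mp hd0, ?_⟩
  rintro - xbar ⟨φs, hmono, hlim⟩
  obtain ⟨κ, hκ⟩ : ∃ κ : ℕ → ℕ, ∀ i, κ i + 1 = φs (i + 1) :=
    ⟨fun i => φs (i + 1) - 1, fun i => Nat.sub_add_cancel
      ((Nat.succ_le_succ (Nat.zero_le i)).trans (hmono.id_le (i + 1)))⟩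
  have hκtop : Tendsto κ atTop atTop := tendsto_atTop_mono
    (fun i => by have := hmono.id_le (i + 1); have := hκ i; simp only [id] at *; omega) tendsto_id
  have hxκ : Tendsto (fun i => x (κ i + 1)) atTop (𝓝 xbar) := by
    simp only [hκ]
    exact hlim.comp (tendsto_add_atTop_nat 1)
  obtain ⟨R, hR⟩ := eventually_norm_le_of_RSubgradAt hh₂cont hxκ fun i => hξ (κ i)
  obtain ⟨w, -, ψ, hψ, hw⟩ := tendsto_subseq_of_frequently_bounded
    (Metric.isBounded_closedBall (x := (0 : Euc n)) (r := R))
    (hR.mono fun i hi => mem_closedBall_zero_iff.mpr hi).frequently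
  obtain ⟨ι, hι⟩ : ∃ ι : ℕ → ℕ, ι = κ ∘ ψ := ⟨_, rfl⟩
  have hιtop : Tendsto ι atTop atTop := hι ▸ hκtop.comp hψ.tendsto_atTop
  have hxι : Tendsto (fun i => x (ι i + 1)) atTop (𝓝 xbar) :=
    hι ▸ hxκ.comp hψ.tendsto_atTop
  have hξι : Tendsto (fun i => ξ (ι i + 1)) atTop (𝓝 w) := hι ▸ hw
  have hnd : Tendsto (fun i => ‖d (ι i + 1)‖) atTop (𝓝 0) := hd0.comp hιtop
  have hdι : Tendsto (fun i => d (ι i + 1)) atTop (𝓝 0) :=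
    tendsto_zero_iff_norm_tendsto_zero.mpr hnd
  have hBd : Tendsto (fun i => Matrix.toEuclideanLin (B (ι i + 1)) (d (ι i + 1))) atTop (𝓝 0) :=
    squeeze_zero_norm (fun i => hbd (ι i) _) (by simpa using hnd.const_mul C)
  have hrι : Tendsto (fun i => r (ι i + 1)) atTop (𝓝 0) := by
    have hsq : Tendsto (fun i => ‖r (ι i + 1)‖ ^ 2) atTop (𝓝 0) := by
      refine squeeze_zero (fun i => sq_nonneg _)
        (fun i => norm_sq_le_of_MNorm_inv_le hc (hpos (ι i)) (hbd (ι i)) ?_)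
        (by simpa using (hnd.pow 2).const_mul (C ^ 2 * c * C))
      refine (hres (ι i)).trans (mul_le_of_le_one_left (Real.sqrt_nonneg _) ?_)
      linarith [(hθ (ι i)).1]
    refine tendsto_zero_iff_norm_tendsto_zero.mpr ?_
    simpa [Real.sqrt_sq_eq_abs] using hsq.sqrt
  have hg'cont : Continuous g' :=
    (LipschitzWith.of_dist_le_mul (K := ⟨L, hL⟩) fun u v => by
      rw [dist_eq_norm, dist_eq_norm]; exact hLip u v).continuous
  have hxpι : Tendsto (fun i => xp (ι i + 1)) atTop (𝓝 xbar) := by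
    have := hxι.add hdι
    simpa [hd] using this
  refine ⟨w - g' xbar, w, ?_, RSubgradAt_of_tendsto hh₂cont hxι hξι fun i => hξ (ι i), by abel⟩
  refine ESubgradAt_of_tendsto hlsc hprop.1 hxpι ?_ fun i => hr (ι i)
  have := (hrι.sub (((hg'cont.tendsto xbar).comp hxι).sub hξι)).sub hBd
  simpa using this
end
end

section
/- Let h₁ : ℝⁿ → ℝ ∪ {+∞} be a proper lower semicontinuous convex function, τ > 0, x̄ ∈ ℝⁿ, and u₁, u₂ ∈ ℝⁿ linearly independent such that B = τI + u₁u₁ᵀ − u₂u₂ᵀ is positive definite. Define ζ(α) = x̄ − (α₁/τ)u₁ + α₂(τI + u₁u₁ᵀ)⁻¹u₂ for α = (α₁, α₂) ∈ ℝ², and define 𝓛 : ℝ² → ℝ² by 𝓛(α) = ( u₁ᵀ(x̄ + α₂(τI + u₁u₁ᵀ)⁻¹u₂ − Prox_{(1/τ)h₁}(ζ(α))) + α₁ , u₂ᵀ(x̄ − Prox_{(1/τ)h₁}(ζ(α))) + α₂ ). If α* ∈ ℝ² satisfies 𝓛(α*) = 0, then Prox_{h₁}^{B}(x̄) = Prox_{(1/τ)h₁}(ζ(α*)),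 i.e., the unique minimizer over x ∈ ℝⁿ of h₁(x) + ½(x − x̄)ᵀB(x − x̄) equals the unique minimizer over x ∈ ℝⁿ of (1/τ)h₁(x) + ½‖x − ζ(α*)‖². -/
open Matrix Filter Topology RealInnerProductSpace

noncomputable section

/-- `p` is the proximal point `Prox_{(1/τ)h₁}(y)`, i.e. the minimizer of
`(1/τ)h₁(·) + ½‖· - y‖²`. -/
def IsProxPt {n : ℕ} (τ : ℝ) (h₁ : Euc n → EReal) (y p : Euc n) : Prop :=
  ∀ w : Euc n, ((τ⁻¹ : ℝ) : EReal) * h₁ p + ((‖p - y‖ ^ 2 / 2 : ℝ) : EReal) ≤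
    ((τ⁻¹ : ℝ) : EReal) * h₁ w + ((‖w - y‖ ^ 2 / 2 : ℝ) : EReal)

/-- The matrix `τI + u₁u₁ᵀ`. -/
def Amat {n : ℕ} (τ : ℝ) (u₁ : Euc n) : Matrix (Fin n) (Fin n) ℝ :=
  τ • (1 : Matrix (Fin n) (Fin n) ℝ) + Matrix.vecMulVec (u₁ : Fin n → ℝ) (u₁ : Fin n → ℝ)

/-- The matrix `B = τI + u₁u₁ᵀ - u₂u₂ᵀ`. -/
def Bprox {n : ℕ} (τ : ℝ) (u₁ u₂ : Euc n) : Matrix (Fin n) (Fin n) ℝ :=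
  Amat τ u₁ - Matrix.vecMulVec (u₂ : Fin n → ℝ) (u₂ : Fin n → ℝ)

/-- `ζ(α) = x̄ - (α₁/τ)u₁ + α₂(τI + u₁u₁ᵀ)⁻¹u₂`. -/
def zetaMap {n : ℕ} (τ : ℝ) (u₁ u₂ xb : Euc n) (α : ℝ × ℝ) : Euc n :=
  xb - (α.1 / τ) • u₁ + α.2 • (Matrix.toEuclideanLin (Amat τ u₁)⁻¹) u₂

/-- The semi-smooth map `𝓛 : ℝ² → ℝ²`, where `P = Prox_{(1/τ)h₁}`. -/
def Lmap {n : ℕ} (τ : ℝ) (u₁ u₂ xb : Euc n) (P : Euc n → Euc n) (α : ℝ × ℝ) : ℝ × ℝ :=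
  (⟪u₁, xb + α.2 • (Matrix.toEuclideanLin (Amat τ u₁)⁻¹) u₂ - P (zetaMap τ u₁ u₂ xb α)⟫ + α.1,
   ⟪u₂, xb - P (zetaMap τ u₁ u₂ xb α)⟫ + α.2)

/-- `p` is the scaled proximal point `Prox_{h₁}^{B}(y)`, i.e. the minimizer of
`h₁(·) + ½‖· - y‖_B²`. -/
def IsScaledProxPt {n : ℕ} (B : Matrix (Fin n) (Fin n) ℝ) (h₁ : Euc n → EReal)
    (y p : Euc n) : Prop :=
  ∀ w : Euc n, h₁ p + ((quadF B (p - y) / 2 : ℝ) : EReal) ≤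
    h₁ w + ((quadF B (w - y) / 2 : ℝ) : EReal)

lemma ESubgradAt.ne_top {n : ℕ} {φ : Euc n → EReal} {v x : Euc n} (hφ : ProperF φ)
    (h : ESubgradAt φ v x) : φ x ≠ ⊤ := by
  obtain ⟨w, hw⟩ := hφ.2
  intro hx
  have hle := h w
  rw [hx, EReal.top_add_coe, top_le_iff] at hle
  exact hw hle

/-- The subdifferential of a proper function is monotone. -/
lemma ESubgradAt.monotone {n : ℕ} {φ : Euc n → EReal} {v w x y : Euc n} (hφ : ProperF φ)
    (hx : ESubgradAt φ v x) (hy : ESubgradAt φ w y) : 0 ≤ ⟪v - w, x - y⟫ := by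
  have hxy := hx y
  have hyx := hy x
  rw [← EReal.coe_toReal (hx.ne_top hφ) (hφ.1 x), ← EReal.coe_toReal (hy.ne_top hφ) (hφ.1 y)]
    at hxy hyx
  norm_cast at hxy hyx
  simp only [inner_sub_left, inner_sub_right] at hxy hyx ⊢
  linarith

/-- Optimality condition for the sum of a convex function and a symmetric quadratic form. -/
lemma esubgradAt_of_forall_add_quadratic_le {n : ℕ} {φ : Euc n → EReal} (hφ : ProperF φ)
    (hconv : EConvexF φ) {T : Euc n →ₗ[ℝ] Euc n} (hT : T.IsSymmetric) {y p : Euc n}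
    (hmin : ∀ w : Euc n, φ p + ((⟪p - y, T (p - y)⟫ / 2 : ℝ) : EReal) ≤
      φ w + ((⟪w - y, T (w - y)⟫ / 2 : ℝ) : EReal)) :
    ESubgradAt φ (-T (p - y)) p := by
  have hp : φ p ≠ ⊤ := by
    obtain ⟨w, hw⟩ := hφ.2
    intro hp
    have hle := hmin w
    rw [hp, EReal.top_add_coe, top_le_iff] at hle
    exact EReal.add_ne_top hw (EReal.coe_ne_top _) hle
  intro w
  by_cases hw : φ w = ⊤
  · simp [hw]
  lift φ p to ℝ using ⟨hp, hφ.1 p⟩ with a ha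
  lift φ w to ℝ using ⟨hw, hφ.1 w⟩ with b hb
  norm_cast
  have key : ∀ t : ℝ, 0 < t → t ≤ 1 →
      a - b - ⟪T (p - y), w - p⟫ ≤ t * (⟪w - p, T (w - p)⟫ / 2) := by
    intro t ht ht1
    have hc := hconv p w (1 - t) t (by linarith) ht.le (by ring)
    have hm := (hmin ((1 - t) • p + t • w)).trans (add_le_add_left hc _)
    rw [← ha, ← hb] at hm
    norm_cast at hm
    have hs : (1 - t) • p + t • w - y = (p - y) + t • (w - p) := by module
    rw [hs, map_add, map_smul, inner_add_left, inner_add_right, inner_add_right,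
      real_inner_smul_left, real_inner_smul_left, real_inner_smul_right, real_inner_smul_right,
      ← hT (p - y) (w - p), real_inner_comm (T (p - y)) (w - p)] at hm
    refine le_of_mul_le_mul_left ?_ ht
    linarith
  by_contra! hlt
  rw [inner_neg_left] at hlt
  set K := ⟪w - p, T (w - p)⟫ / 2
  set c := a - b - ⟪T (p - y), w - p⟫
  have hc : 0 < c := by simp only [c]; linarith
  have hden : 0 < c + |K| := by positivity
  have h := key (c / (c + |K|)) (by positivity)
    ((div_le_one hden).2 (le_add_of_nonneg_right (abs_nonneg K)))
  rw [div_mul_eq_mul_div, le_div_iff₀ hden] at h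
  nlinarith [le_abs_self K]

lemma IsScaledProxPt.esubgradAt {n : ℕ} {φ : Euc n → EReal} (hφ : ProperF φ)
    (hconv : EConvexF φ) {B : Matrix (Fin n) (Fin n) ℝ} (hB : B.IsHermitian) {y p : Euc n}
    (h : IsScaledProxPt B φ y p) : ESubgradAt φ (-(Matrix.toEuclideanLin B (p - y))) p :=
  esubgradAt_of_forall_add_quadratic_le hφ hconv
    (Matrix.isSymmetric_toEuclideanLin_iff.2 hB) h

lemma IsProxPt.esubgradAt {n : ℕ} {φ : Euc n → EReal} (hφ : ProperF φ)
    (hconv : EConvexF φ) {τ : ℝ} (hτ : 0 < τ) {y p : Euc n}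
    (h : IsProxPt τ φ y p) : ESubgradAt φ (-(τ • (p - y))) p := by
  have hτi : 0 < τ⁻¹ := inv_pos.2 hτ
  have hT : (τ • LinearMap.id : Euc n →ₗ[ℝ] Euc n).IsSymmetric := fun u v => by
    simp only [LinearMap.smul_apply, LinearMap.id_apply, real_inner_smul_left,
      real_inner_smul_right]
  have hmin := esubgradAt_of_forall_add_quadratic_le (y := y) (p := p) hφ hconv hT
  simp only [LinearMap.smul_apply, LinearMap.id_apply, real_inner_smul_right,
    real_inner_self_eq_norm_sq] at hmin
  refine hmin fun w => ?_
  have hw := h w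
  by_cases hwt : φ w = ⊤
  · simp [hwt]
  have hpt : φ p ≠ ⊤ := by
    intro hpt
    lift φ w to ℝ using ⟨hwt, hφ.1 w⟩ with b
    rw [hpt, EReal.coe_mul_top_of_pos hτi, EReal.top_add_coe, top_le_iff] at hw
    norm_cast at hw
    exact EReal.coe_ne_top _ hw
  lift φ p to ℝ using ⟨hpt, hφ.1 p⟩ with a
  lift φ w to ℝ using ⟨hwt, hφ.1 w⟩ with b
  norm_cast at hw ⊢
  have hmul := mul_le_mul_of_nonneg_left hw hτ.le
  rw [mul_add, mul_add, mul_inv_cancel_left₀ hτ.ne', mul_inv_cancel_left₀ hτ.ne'] at hmul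
  linarith

lemma IsProxPt.unique {n : ℕ} {φ : Euc n → EReal} (hφ : ProperF φ)
    (hconv : EConvexF φ) {τ : ℝ} (hτ : 0 < τ) {y p q : Euc n}
    (hp : IsProxPt τ φ y p) (hq : IsProxPt τ φ y q) : p = q := by
  have h := (hp.esubgradAt hφ hconv hτ).monotone hφ (hq.esubgradAt hφ hconv hτ)
  have hs : -(τ • (p - y)) - -(τ • (q - y)) = -(τ • (p - q)) := by module
  rw [hs, inner_neg_left, real_inner_smul_left, real_inner_self_eq_norm_sq] at h
  have h0 : ‖p - q‖ ^ 2 ≤ 0 := by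
    by_contra! hlt
    nlinarith [mul_pos hτ hlt]
  exact sub_eq_zero.1 (norm_eq_zero.1 (pow_eq_zero_iff two_ne_zero |>.1
    (le_antisymm h0 (sq_nonneg _))))

lemma toEuclideanLin_vecMulVec_self {n : ℕ} (u x : Euc n) :
    Matrix.toEuclideanLin (Matrix.vecMulVec (u : Fin n → ℝ) (u : Fin n → ℝ)) x =
      ⟪u, x⟫ • u := by
  ext i
  simp [Matrix.toLpLin_apply, Matrix.vecMulVec_mulVec, PiLp.inner_apply, dotProduct, mul_comm]

lemma toEuclideanLin_Amat {n : ℕ} (τ : ℝ) (u x : Euc n) :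
    Matrix.toEuclideanLin (Amat τ u) x = τ • x + ⟪u, x⟫ • u := by
  rw [Amat, map_add, LinearMap.add_apply, toEuclideanLin_vecMulVec_self, map_smul]
  simp

lemma toEuclideanLin_Bprox {n : ℕ} (τ : ℝ) (u₁ u₂ x : Euc n) :
    Matrix.toEuclideanLin (Bprox τ u₁ u₂) x = τ • x + ⟪u₁, x⟫ • u₁ - ⟪u₂, x⟫ • u₂ := by
  rw [Bprox, map_sub, LinearMap.sub_apply, toEuclideanLin_Amat, toEuclideanLin_vecMulVec_self]

lemma Amat_posDef {n : ℕ} {τ : ℝ} (hτ : 0 < τ) (u : Euc n) : (Amat τ u).PosDef := by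
  refine (Matrix.PosDef.one.smul hτ).add_posSemidef ?_
  simpa using Matrix.posSemidef_vecMulVec_self_star (u : Fin n → ℝ)

lemma toEuclideanLin_Amat_inv {n : ℕ} {τ : ℝ} (hτ : 0 < τ) (u x : Euc n) :
    Matrix.toEuclideanLin (Amat τ u) (Matrix.toEuclideanLin (Amat τ u)⁻¹ x) = x := by
  have hdet : IsUnit (Amat τ u).det := (Matrix.isUnit_iff_isUnit_det _).1 (Amat_posDef hτ u).isUnit
  ext i
  simp [Matrix.toLpLin_apply, Matrix.mulVec_mulVec, Matrix.mul_nonsing_inv _ hdet]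

/-- At a root of `𝓛`, the gradients of the two quadratic terms agree at the proximal point. -/
lemma smul_sub_zetaMap_eq_of_Lmap_eq_zero {n : ℕ} {τ : ℝ} (hτ : 0 < τ) {u₁ u₂ xb : Euc n}
    {P : Euc n → Euc n} {α : ℝ × ℝ} (hroot : Lmap τ u₁ u₂ xb P α = 0) :
    τ • (P (zetaMap τ u₁ u₂ xb α) - zetaMap τ u₁ u₂ xb α) =
      Matrix.toEuclideanLin (Bprox τ u₁ u₂) (P (zetaMap τ u₁ u₂ xb α) - xb) := by
  obtain ⟨h₁, h₂⟩ := Prod.ext_iff.1 hroot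
  simp only [Lmap, Prod.fst_zero, Prod.snd_zero] at h₁ h₂
  have hv := toEuclideanLin_Amat_inv hτ u₁ u₂
  rw [toEuclideanLin_Amat] at hv
  rw [toEuclideanLin_Bprox]
  generalize P (zetaMap τ u₁ u₂ xb α) = q at h₁ h₂ ⊢
  rw [zetaMap]
  generalize Matrix.toEuclideanLin (Amat τ u₁)⁻¹ u₂ = v at h₁ hv ⊢
  have e₁ : α.1 = ⟪u₁, q - xb⟫ - α.2 * ⟪u₁, v⟫ := by
    simp only [inner_sub_right, inner_add_right, real_inner_smul_right] at h₁ ⊢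
    linarith
  have e₂ : ⟪u₂, q - xb⟫ = α.2 := by
    simp only [inner_sub_right] at h₂ ⊢
    linarith
  calc τ • (q - (xb - (α.1 / τ) • u₁ + α.2 • v))
      = τ • (q - xb) + (τ * (α.1 / τ)) • u₁ - α.2 • (τ • v) := by module
    _ = τ • (q - xb) + α.1 • u₁ - α.2 • (u₂ - ⟪u₁, v⟫ • u₁) := by
      rw [mul_div_cancel₀ _ hτ.ne', eq_sub_of_add_eq hv]
    _ = τ • (q - xb) + ⟪u₁, q - xb⟫ • u₁ - ⟪u₂, q - xb⟫ • u₂ := by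
      rw [e₁, e₂]; module

lemma quadF_pos {n : ℕ} {B : Matrix (Fin n) (Fin n) ℝ} (hB : B.PosDef) {x : Euc n}
    (hx : x ≠ 0) : 0 < quadF B x := by
  have hx' : (x : Fin n → ℝ) ≠ 0 := fun h => hx (by ext i; exact congrFun h i)
  have h := hB.dotProduct_mulVec_pos hx'
  simpa [quadF, Matrix.toLpLin_apply, PiLp.inner_apply, dotProduct, mul_comm] using h

/-- if `𝓛(α*) = 0`, then the scaled proximal point `Prox_{h₁}^{B}(x̄)`
equals the proximal point `Prox_{(1/τ)h₁}(ζ(α*))`. -/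
theorem scaled_prox_eq_prox_of_Lmap_root
    {n : ℕ} (τ : ℝ) (u₁ u₂ xb : Euc n)
    (h₁ : Euc n → EReal) (P : Euc n → Euc n)
    (hprop : ProperF h₁) (hlsc : LowerSemicontinuous h₁) (hconv : EConvexF h₁)
    (hτ : 0 < τ)
    (hind : LinearIndependent ℝ ![u₁, u₂])
    (hpd : (Bprox τ u₁ u₂).PosDef)
    (hP : ∀ y : Euc n, IsProxPt τ h₁ y (P y))
    (αstar : ℝ × ℝ) (hroot : Lmap τ u₁ u₂ xb P αstar = 0) :
    ∀ p q : Euc n, IsScaledProxPt (Bprox τ u₁ u₂) h₁ xb p →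
      IsProxPt τ h₁ (zetaMap τ u₁ u₂ xb αstar) q → p = q := by
  intro p q hp hq
  rw [hq.unique hprop hconv hτ (hP _)]
  have h := (hp.esubgradAt hprop hconv hpd.1).monotone hprop
    ((hP (zetaMap τ u₁ u₂ xb αstar)).esubgradAt hprop hconv hτ)
  rw [smul_sub_zetaMap_eq_of_Lmap_eq_zero hτ hroot, ← neg_sub', ← map_sub, sub_sub_sub_cancel_right,
    inner_neg_left, real_inner_comm] at h
  by_contra hne
  have hpos := quadF_pos hpd (sub_ne_zero.2 hne)
  rw [quadF] at hpos
  linarith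
end
end
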